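/- (Variant of Theorem 1.1(1) with hyperplane sections of the singular locus, stable case.) Suppose δ ≥ 1 is an integer such that ord_0(f_h) ≤ δ for every h ∈ GL_{N+1}(k), and s′ ≥ −1 is an integer such that for every nonzero linear form ℓ ∈ k[X_0,…,X_N]_1, the Krull dimension of the quotient of k[X_0,…,X_N] by the ideal generated by ℓ, F and the partial derivatives ∂F/∂X_0,…,∂F/∂X_N is at most s′+1 (i.e. dim(H_sing ∩ V) ≤ s′ for every hyperplane V of P^N_k). If d > δ·min(N+1, s′+3), then for every g ∈ GL_{N+1}(k) and every nonzero α ∈ ℤ^{N+1} with Σ_{i=0}^N α_i = 0, one has deg_α(F∘g) > 0; that is, F satisfies the Hilbert–Mumford criterion for stability, so H is stable. -/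

import Mathlib

open MvPolynomial

/-- The `α`-degree of a multivariate polynomial `G`: the maximum of `∑ i, m i * α i`
over the monomials `X^m` occurring in `G` with nonzero coefficient (0 if `G = 0`). -/
noncomputable def adeg {k : Type*} [CommSemiring k] {n : ℕ} (α : Fin n → ℤ)
    (G : MvPolynomial (Fin n) k) : ℤ :=
  if h : G.support.Nonempty then G.support.sup' h (fun m => ∑ i, (m i : ℤ) * α i) else 0

/-- `F ∘ g`: the polynomial obtained from `F` by the substitution `X i ↦ ∑ j, g i j • X j`. -/
noncomputable def substGL {k : Type*} [CommRing k] {n : ℕ}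
    (g : Matrix (Fin n) (Fin n) k) (F : MvPolynomial (Fin n) k) :
    MvPolynomial (Fin n) k :=
  aeval (fun i => ∑ j, C (g i j) * X j) F

/-- Dehomogenization with respect to the last variable:
`G(X_0, …, X_N) ↦ G(x_0, …, x_{N-1}, 1)`. -/
noncomputable def dehom {k : Type*} [CommRing k] {N : ℕ}
    (G : MvPolynomial (Fin (N+1)) k) : MvPolynomial (Fin N) k :=
  aeval (fun i : Fin (N+1) => if h : (i : ℕ) < N then X ⟨i, h⟩ else 1) G

/-- `ord_0 f`: the minimal total degree of a monomial occurring in `f`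
with nonzero coefficient (0 if `f = 0`). -/
noncomputable def ord0 {k : Type*} [CommSemiring k] {N : ℕ}
    (f : MvPolynomial (Fin N) k) : ℕ :=
  if h : f.support.Nonempty then f.support.inf' h (fun m => ∑ i, m i) else 0

/-- The ideal generated by `F` and its partial derivatives, defining the singular
locus `H_sing` of the hypersurface `H = {F = 0}`. -/
noncomputable def jacobianIdeal {k : Type*} [CommRing k] {N : ℕ}
    (F : MvPolynomial (Fin (N+1)) k) : Ideal (MvPolynomial (Fin (N+1)) k) :=
  Ideal.span ({F} ∪ Set.range (fun i => pderiv i F))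

theorem substGL_mul {k : Type*} [CommRing k] {n : ℕ} (g h : Matrix (Fin n) (Fin n) k)
    (F : MvPolynomial (Fin n) k) : substGL h (substGL g F) = substGL (g * h) F := by
  unfold substGL
  rw [← AlgHom.comp_apply]
  congr 1
  ext1 i
  simp only [AlgHom.comp_apply, aeval_X, map_sum, map_mul, Matrix.mul_apply, Finset.mul_sum,
    Finset.sum_mul, algHom_C, MvPolynomial.algebraMap_eq]
  rw [Finset.sum_comm]
  simp only [mul_assoc]

theorem substGL_one {k : Type*} [CommRing k] {n : ℕ} (F : MvPolynomial (Fin n) k) :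
    substGL 1 F = F := by
  have : (fun i : Fin n => ∑ j, C ((1 : Matrix (Fin n) (Fin n) k) i j) * X j) =
      (X : Fin n → MvPolynomial (Fin n) k) := by
    ext1 i
    simp [Matrix.one_apply]
  simp [substGL, this]

theorem isHomogeneous_substGL {k : Type*} [CommRing k] {n d : ℕ} (g : Matrix (Fin n) (Fin n) k)
    {F : MvPolynomial (Fin n) k} (hF : F.IsHomogeneous d) : (substGL g F).IsHomogeneous d := by
  have := hF.aeval (fun i => ∑ j, C (g i j) * (X j : MvPolynomial (Fin n) k)) (n := 1)
    fun i => IsHomogeneous.sum _ _ _ fun j _ => isHomogeneous_C_mul_X _ _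
  simpa [substGL] using this

theorem substGL_ne_zero {k : Type*} [CommRing k] {n : ℕ} (g : Matrix.GeneralLinearGroup (Fin n) k)
    {F : MvPolynomial (Fin n) k} (hF : F ≠ 0) : substGL (↑g) F ≠ 0 := by
  intro h
  apply hF
  rw [← substGL_one F, ← g.mul_inv, ← substGL_mul, h]
  simp [substGL]

/-- The chain rule for a linear substitution. -/
theorem pderiv_substGL {k : Type*} [CommRing k] {n : ℕ} (g : Matrix (Fin n) (Fin n) k)
    (F : MvPolynomial (Fin n) k) (j : Fin n) :
    pderiv j (substGL g F) = ∑ i, C (g i j) * substGL g (pderiv i F) := by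
  induction F using MvPolynomial.induction_on with
  | C a => simp [substGL]
  | add p q hp hq =>
    simp only [substGL, map_add, mul_add, Finset.sum_add_distrib] at hp hq ⊢
    rw [hp, hq]
  | mul_X p i hp =>
    simp only [substGL, map_mul, aeval_X, Derivation.leibniz, smul_eq_mul, map_add, mul_add,
      Finset.sum_add_distrib] at hp ⊢
    rw [hp]
    congr 1
    · simp [pderiv_X, Pi.single_apply, Finset.sum_ite_eq, apply_ite, mul_comm]
    · rw [Finset.mul_sum]
      exact Finset.sum_congr rfl fun _ _ => by ring

theorem substGL_pderiv {k : Type*} [CommRing k] {n : ℕ} (g : Matrix.GeneralLinearGroup (Fin n) k)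
    (F : MvPolynomial (Fin n) k) (i : Fin n) :
    substGL (↑g) (pderiv i F) =
      ∑ j, C ((↑g⁻¹ : Matrix (Fin n) (Fin n) k) j i) * pderiv j (substGL (↑g) F) := by
  simp only [pderiv_substGL, Finset.mul_sum, ← mul_assoc, ← C_mul]
  rw [Finset.sum_comm]
  simp only [← Finset.sum_mul]
  have h (x : Fin n) : ∑ j, (↑g⁻¹ : Matrix (Fin n) (Fin n) k) j i * g x j =
      (1 : Matrix (Fin n) (Fin n) k) x i := by
    rw [← g.mul_inv, Matrix.mul_apply]
    exact Finset.sum_congr rfl fun _ _ => mul_comm _ _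
  simp only [← map_sum, h]
  simp [Matrix.one_apply]

theorem substGL_submatrix {k : Type*} [CommRing k] {n : ℕ} (g : Matrix (Fin n) (Fin n) k)
    (σ : Equiv.Perm (Fin n)) (F : MvPolynomial (Fin n) k) :
    substGL (g.submatrix id σ) F = rename σ.symm (substGL g F) := by
  unfold substGL
  rw [← AlgHom.comp_apply]
  congr 1
  ext1 i
  simp only [AlgHom.comp_apply, aeval_X, map_sum, map_mul, rename_C, rename_X, Matrix.submatrix_apply, id]
  exact Fintype.sum_equiv σ _ _ fun j => by simp

theorem dehom_eq_sum {k : Type*} [CommRing k] {N : ℕ} (G : MvPolynomial (Fin (N + 1)) k) :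
    dehom G = ∑ m ∈ G.support,
      monomial (m.comapDomain Fin.castSucc (Fin.castSucc_injective N).injOn) (coeff m G) := by
  conv_lhs => rw [G.as_sum, dehom, map_sum]
  refine Finset.sum_congr rfl fun m _ => ?_
  rw [aeval_monomial, Finsupp.prod_fintype _ _ (by simp), Fin.prod_univ_castSucc, monomial_eq,
    Finsupp.prod_fintype _ _ (by simp)]
  simp [MvPolynomial.algebraMap_eq]

theorem coeff_dehom {k : Type*} [CommRing k] {N d : ℕ} {G : MvPolynomial (Fin (N + 1)) k}
    (hG : G.IsHomogeneous d) {m : Fin (N + 1) →₀ ℕ} (hm : m ∈ G.support) :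
    coeff (m.comapDomain Fin.castSucc (Fin.castSucc_injective N).injOn) (dehom G) =
      coeff m G := by
  have hdeg {b : Fin (N + 1) →₀ ℕ} (hb : b ∈ G.support) :
      ∑ i : Fin N, b i.castSucc + b (Fin.last N) = d := by
    rw [← Fin.sum_univ_castSucc, ← Finsupp.degree_eq_sum]
    by_contra h
    exact mem_support_iff.1 hb (hG.coeff_eq_zero h)
  rw [dehom_eq_sum, coeff_sum, Finset.sum_eq_single_of_mem m hm, coeff_monomial, if_pos rfl]
  intro b hb hbm
  rw [coeff_monomial, if_neg]
  intro h
  have h' (i : Fin N) : b i.castSucc = m i.castSucc := DFunLike.congr_fun h i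
  refine hbm (Finsupp.ext fun i => ?_)
  induction i using Fin.lastCases with
  | cast i => exact h' i
  | last =>
    have h1 := hdeg hb
    have h2 := hdeg hm
    simp only [h'] at h1
    omega

theorem exists_mem_support_of_mem_support_dehom {k : Type*} [CommRing k] {N : ℕ}
    {G : MvPolynomial (Fin (N + 1)) k} {m : Fin N →₀ ℕ} (hm : m ∈ (dehom G).support) :
    ∃ m' ∈ G.support, m = m'.comapDomain Fin.castSucc (Fin.castSucc_injective N).injOn := by
  classical
  rw [dehom_eq_sum] at hm
  obtain ⟨m', hm', h⟩ := Finset.mem_biUnion.1 (support_sum hm)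
  exact ⟨m', hm', Finset.mem_singleton.1 (support_monomial_subset h)⟩

theorem exists_mem_support_sum_le {k : Type*} [CommRing k] {N d δ : ℕ}
    {G : MvPolynomial (Fin (N + 1)) k} (hG : G.IsHomogeneous d) (hG0 : G ≠ 0)
    (h : ord0 (dehom G) ≤ δ) : ∃ m ∈ G.support, ∑ i : Fin N, m i.castSucc ≤ δ := by
  obtain ⟨m, hm⟩ := support_nonempty.2 hG0
  have hne : (dehom G).support.Nonempty := by
    refine ⟨m.comapDomain Fin.castSucc (Fin.castSucc_injective N).injOn, ?_⟩
    rw [mem_support_iff, coeff_dehom hG hm]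
    exact mem_support_iff.1 hm
  rw [ord0, dif_pos hne, Finset.inf'_le_iff] at h
  obtain ⟨b, hb, hbδ⟩ := h
  obtain ⟨m', hm', rfl⟩ := exists_mem_support_of_mem_support_dehom hb
  exact ⟨m', hm', by simpa using hbδ⟩

/-- The irrelevant ideal of a polynomial ring in `n` variables has height at least `n`. -/
theorem le_height_ker_constantCoeff (k : Type*) [Field k] (n : ℕ) :
    (n : ℕ∞) ≤ (RingHom.ker (constantCoeff : MvPolynomial (Fin n) k →+* k)).height := by
  let φ (i : ℕ) : MvPolynomial (Fin n) k →ₐ[k] MvPolynomial (Fin n) k :=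
    aeval fun j : Fin n => if (j : ℕ) < i then 0 else X j
  have hφ (i : ℕ) : (RingHom.ker (φ i)).IsPrime := RingHom.ker_isPrime _
  have key : ∀ i ≤ n, (i : ℕ∞) ≤ (RingHom.ker (φ i)).height := by
    intro i
    induction i with
    | zero => simp
    | succ i ih =>
      intro hi
      have hlt : RingHom.ker (φ i) < RingHom.ker (φ (i + 1)) := by
        refine lt_of_le_of_ne (fun p hp => ?_) fun heq => ?_
        · have hcomp : φ (i + 1) = (φ (i + 1)).comp (φ i) := by
            ext1 j
            by_cases h : (j : ℕ) < i
            · simp [φ, h, h.le]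
            · simp [φ, h]
          rw [RingHom.mem_ker] at hp ⊢
          rw [hcomp, AlgHom.comp_apply, hp, map_zero]
        · have : (X ⟨i, hi⟩ : MvPolynomial (Fin n) k) ∈ RingHom.ker (φ i) := by
            rw [heq, RingHom.mem_ker]
            simp [φ]
          rw [RingHom.mem_ker] at this
          simp [φ] at this
      calc ((i + 1 : ℕ) : ℕ∞) ≤ (RingHom.ker (φ i)).height + 1 := by
            push_cast
            gcongr
            exact ih (by omega)
        _ ≤ _ := Ideal.height_add_one_le_of_lt_of_isPrime hlt
  refine (key n le_rfl).trans_eq ?_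
  congr 1
  ext p
  have h0 : (fun j : Fin n => if (j : ℕ) < n then (0 : MvPolynomial (Fin n) k) else X j) = 0 := by
    ext1 j
    simp
  rw [RingHom.mem_ker, RingHom.mem_ker]
  simp only [φ, h0]
  rw [aeval_zero]
  simp

/-- An ideal generated by at most `M` polynomials without constant term defines
a scheme of dimension at least `n - M`. -/
theorem le_ringKrullDim_quotient_span {k : Type*} [Field k] {n M r : ℕ}
    (s : Set (MvPolynomial (Fin n) k)) (hs : ∀ p ∈ s, constantCoeff p = 0) (hM : s.encard ≤ M)
    (hr : M + r ≤ n) : (r : WithBot ℕ∞) ≤ ringKrullDim (MvPolynomial (Fin n) k ⧸ Ideal.span s) := by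
  have : (RingHom.ker (constantCoeff : MvPolynomial (Fin n) k →+* k)).IsPrime :=
    RingHom.ker_isPrime _
  have h1 := Ideal.height_le_ringKrullDim_quotient_add_encard s
    (p := RingHom.ker (constantCoeff : MvPolynomial (Fin n) k →+* k)) hs
  have h2 : ((n : ℕ∞) : WithBot ℕ∞) ≤ ringKrullDim (MvPolynomial (Fin n) k ⧸ Ideal.span s) +
      ((M : ℕ∞) : WithBot ℕ∞) :=
    (WithBot.coe_le_coe.2 (le_height_ker_constantCoeff k n)).trans <| h1.trans <| by
      gcongr
      exact WithBot.coe_le_coe.2 hM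
  generalize ringKrullDim (MvPolynomial (Fin n) k ⧸ Ideal.span s) = D at h2 ⊢
  induction D with
  | bot => simp at h2
  | coe D =>
    induction D with
    | top => simp
    | coe D =>
      norm_cast at h2 ⊢
      omega

/-- If a nondecreasing family of weights of sum zero has a very negative first member, then there
is a positive weight `α j`, `1 ≤ j`, whose mirror image `α i` is not too negative. -/
theorem exists_pos_add_mul_pos {N r : ℕ} {α : Fin (N + 1) → ℤ} (hα : Monotone α)
    (hsum : ∑ i, α i = 0) (hpos : 0 < α (Fin.last N)) (hr1 : 1 ≤ r) (hrN : r ≤ N)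
    (h0 : α 0 + r * α (Fin.last N) < 0) {D : ℤ} (hD : 1 ≤ D) :
    ∃ i j : Fin (N + 1), 1 ≤ (j : ℕ) ∧ (i : ℕ) + j + r = N + 1 ∧ 0 < α j ∧
      0 < α i + D * α j := by
  obtain ⟨r, rfl⟩ : ∃ r', r = r' + 1 := ⟨r - 1, by omega⟩
  obtain ⟨M, rfl⟩ : ∃ M, N = M + 1 + r := ⟨N - 1 - r, by omega⟩
  by_contra! H
  let a (i : ℕ) : ℤ := α (Fin.ofNat _ i)
  have ha {i : ℕ} (hi : i < M + 1 + r + 1) : a i = α ⟨i, hi⟩ := by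
    simp [a, Fin.ofNat, Nat.mod_eq_of_lt hi]
  have hle {i : ℕ} (hi : i < M + 1 + r + 1) : a i ≤ α (Fin.last _) := by
    rw [ha hi]
    exact hα (Fin.le_last _)
  have hsum' : ∑ i ∈ Finset.range (M + 1 + 1 + r), a i = 0 := by
    rw [← hsum, show M + 1 + 1 + r = M + 1 + r + 1 by ring, Finset.sum_range]
    exact Finset.sum_congr rfl fun i _ => ha i.2
  have hpair : ∀ i ∈ Finset.range M, a (i + 1) + a (M - 1 - i + 1) ≤ 0 := by
    intro i hi
    rw [Finset.mem_range] at hi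
    have h1 := H ⟨i + 1, by omega⟩ ⟨M - 1 - i + 1, by omega⟩ (by simp) (by simp; omega)
    have h2 := H ⟨M - 1 - i + 1, by omega⟩ ⟨i + 1, by omega⟩ (by simp) (by simp; omega)
    rw [← ha, ← ha] at h1 h2
    by_cases h3 : 0 < a (i + 1)
    · nlinarith [h2 h3]
    by_cases h4 : 0 < a (M - 1 - i + 1)
    · nlinarith [h1 h4]
    omega
  have hmid : ∑ i ∈ Finset.range M, a (i + 1) ≤ 0 := by
    have := Finset.sum_nonpos hpair
    rw [Finset.sum_add_distrib, Finset.sum_range_reflect fun i => a (i + 1)] at this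
    omega
  have htop : ∑ i ∈ Finset.range r, a (M + 1 + 1 + i) ≤ r * α (Fin.last _) := by
    refine (Finset.sum_le_card_nsmul _ _ (α (Fin.last _)) fun i hi => hle ?_).trans_eq (by simp)
    rw [Finset.mem_range] at hi
    omega
  rw [Finset.sum_range_add, Finset.sum_range_succ, Finset.sum_range_succ'] at hsum'
  have h1 := hle (i := M + 1) (by omega)
  have h2 : a 0 = α 0 := ha (by omega)
  push_cast at h0
  linarith

/-- If every monomial of `G` has nonpositive weight, then the singular locus of `G = 0` contains
the part of a coordinate subspace cut out by few equations. -/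
theorem exists_span_of_weight_nonpos {k : Type*} [CommRing k] {N d : ℕ} (hd : 2 ≤ d)
    {G : MvPolynomial (Fin (N + 1)) k} (hG : G.IsHomogeneous d) {α : Fin (N + 1) → ℤ}
    (hα : Monotone α) (hw : ∀ m ∈ G.support, ∑ i, (m i : ℤ) * α i ≤ 0)
    {i j : Fin (N + 1)} (hj1 : 1 ≤ (j : ℕ)) (hj : 0 < α j)
    (hij : 0 < α i + ((d : ℤ) - 1) * α j) :
    ∃ s : Set (MvPolynomial (Fin (N + 1)) k), (∀ p ∈ s, constantCoeff p = 0) ∧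
      s.encard ≤ (i + j : ℕ) ∧ X 0 ∈ Ideal.span s ∧ G ∈ Ideal.span s ∧
      ∀ l, pderiv l G ∈ Ideal.span s := by
  have hdeg {m : Fin (N + 1) →₀ ℕ} (hm : m ∈ G.support) : ∑ l, (m l : ℤ) = d := by
    have : m.degree = d := by
      by_contra h
      exact mem_support_iff.1 hm (hG.coeff_eq_zero h)
    rw [← this, Finsupp.degree_eq_sum]
    push_cast
    rfl
  have hweight {m : Fin (N + 1) →₀ ℕ} (hm : ∀ l ∈ Set.Iio j, m l = 0) :
      (∑ l, (m l : ℤ)) * α j ≤ ∑ l, (m l : ℤ) * α l := by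
    rw [Finset.sum_mul]
    refine Finset.sum_le_sum fun l _ => ?_
    by_cases hl : l < j
    · simp [hm l hl]
    · exact mul_le_mul_of_nonneg_left (hα (not_lt.1 hl)) (by positivity)
  let A : Set (MvPolynomial (Fin (N + 1)) k) := X '' Set.Iio j
  let B : Set (MvPolynomial (Fin (N + 1)) k) := (fun l => pderiv l G) '' Set.Iio i
  have hA : Ideal.span A ≤ Ideal.span (A ∪ B) := Ideal.span_mono Set.subset_union_left
  refine ⟨A ∪ B, ?_, ?_, ?_, ?_, ?_⟩
  · rintro _ (⟨l, -, rfl⟩ | ⟨l, -, rfl⟩)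
    · simp
    · rw [constantCoeff_eq]
      exact hG.pderiv.coeff_eq_zero (by simp; omega)
  · refine (Set.encard_union_le _ _).trans ?_
    rw [add_comm i.1, Nat.cast_add]
    refine add_le_add ((Set.encard_image_le _ _).trans_eq ?_)
      ((Set.encard_image_le _ _).trans_eq ?_) <;>
    rw [← Finset.coe_Iio, Set.encard_coe_eq_coe_finsetCard, Fin.card_Iio]
  · exact hA (Ideal.subset_span ⟨0, Fin.lt_def.2 hj1, rfl⟩)
  · refine hA (mem_ideal_span_X_image.2 fun m hm => ?_)
    by_contra! h
    have := hweight h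
    rw [hdeg hm] at this
    have h2 := hw m hm
    have : 0 < (d : ℤ) * α j := by positivity
    omega
  · intro l
    by_cases hl : l < i
    · exact Ideal.subset_span (Or.inr ⟨l, hl, rfl⟩)
    refine hA (mem_ideal_span_X_image.2 fun m hm => ?_)
    by_contra! h
    have hm' : m + Finsupp.single l 1 ∈ G.support := by
      rw [mem_support_iff, coeff_pderiv] at hm
      exact mem_support_iff.2 (left_ne_zero_of_mul hm)
    have h1 := hdeg hm'
    have h2 := hw _ hm'
    have h3 := hweight h
    simp only [Finsupp.add_apply, Nat.cast_add, add_mul, Finset.sum_add_distrib,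
      Finsupp.single_apply, Nat.cast_ite, ite_mul, Nat.cast_one, one_mul, Nat.cast_zero, zero_mul,
      Finset.sum_ite_eq, Finset.mem_univ, if_true] at h1 h2
    rw [eq_sub_of_add_eq h1] at h3
    have h4 := hα (not_lt.1 hl)
    omega

/-- The main estimate, after reordering the coordinates so that the weights are nondecreasing. -/
theorem exists_weight_pos_of_monotone {k : Type*} [Field k] {N d : ℕ} (hd : 2 ≤ d)
    {F : MvPolynomial (Fin (N + 1)) k} (hF0 : F ≠ 0) (hFhom : F.IsHomogeneous d)
    {δ : ℕ} (hδ : 1 ≤ δ) {s' : ℤ} (hs' : -1 ≤ s')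
    (hsing : ∀ ℓ : MvPolynomial (Fin (N + 1)) k, ℓ ≠ 0 → ℓ.IsHomogeneous 1 →
      ringKrullDim (MvPolynomial (Fin (N + 1)) k ⧸
          Ideal.span ({ℓ, F} ∪ Set.range (fun i => pderiv i F)))
        ≤ ((s' + 1).toNat : WithBot ℕ∞))
    (hdeg : (δ : ℤ) * min ((N : ℤ) + 1) (s' + 3) < (d : ℤ))
    (g : Matrix.GeneralLinearGroup (Fin (N + 1)) k)
    (hmult : ord0 (dehom (substGL (↑g) F)) ≤ δ) {α : Fin (N + 1) → ℤ} (hα : Monotone α)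
    (hα0 : α ≠ 0) (hsum : ∑ i, α i = 0) :
    ∃ m ∈ (substGL (↑g) F).support, 0 < ∑ i, (m i : ℤ) * α i := by
  by_contra! hw
  have hGhom := isHomogeneous_substGL (g : Matrix (Fin (N + 1)) (Fin (N + 1)) k) hFhom
  have hpos : 0 < α (Fin.last N) := by
    by_contra! h
    refine hα0 (funext fun i => ?_)
    exact (Finset.sum_eq_zero_iff_of_nonpos fun i _ => (hα (Fin.le_last i)).trans h).1 hsum i
      (Finset.mem_univ i)
  have hmin : α 0 ≤ α (Fin.last N) := hα (Fin.zero_le _)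
  have h1 : (δ : ℤ) * α 0 + (d - δ) * α (Fin.last N) ≤ 0 := by
    obtain ⟨m, hm, hmδ⟩ := exists_mem_support_sum_le hGhom (substGL_ne_zero g hF0) hmult
    have hmd : ∑ i : Fin N, (m i.castSucc : ℤ) + m (Fin.last N) = d := by
      rw [← Fin.sum_univ_castSucc fun i => (m i : ℤ)]
      have : m.degree = d := by
        by_contra h
        exact mem_support_iff.1 hm (hGhom.coeff_eq_zero h)
      rw [← this, Finsupp.degree_eq_sum]
      push_cast
      rfl
    have h2 := hw m hm
    rw [Fin.sum_univ_castSucc] at h2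
    have h3 : (∑ i : Fin N, (m i.castSucc : ℤ)) * α 0 ≤
        ∑ i : Fin N, (m i.castSucc : ℤ) * α i.castSucc := by
      rw [Finset.sum_mul]
      exact Finset.sum_le_sum fun i _ =>
        mul_le_mul_of_nonneg_left (hα (Fin.zero_le _)) (by positivity)
    have h4 : ∑ i : Fin N, (m i.castSucc : ℤ) ≤ δ := by exact_mod_cast hmδ
    rw [← hmd]
    nlinarith [mul_nonneg (sub_nonneg.2 h4) (sub_nonneg.2 hmin)]
  have key (r : ℕ) (hr : (δ : ℤ) * (r + 1) < d) : α 0 + r * α (Fin.last N) < 0 := by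
    have hδ' : (0 : ℤ) < δ := by exact_mod_cast hδ
    by_contra! h
    nlinarith [mul_nonneg hδ'.le h, mul_lt_mul_of_pos_right hr hpos]
  rcases le_or_gt ((N : ℤ) + 1) (s' + 3) with hNs | hNs
  · rw [min_eq_left hNs] at hdeg
    have h2 := key N hdeg
    rw [Fin.sum_univ_succ] at hsum
    have h3 : ∑ i : Fin N, α i.succ ≤ N * α (Fin.last N) :=
      (Finset.sum_le_card_nsmul _ _ (α (Fin.last N)) fun i _ => hα (Fin.le_last _)).trans_eq
        (by simp)
    linarith
  · rw [min_eq_right hNs.le] at hdeg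
    obtain ⟨r, hr⟩ : ∃ r : ℕ, s' + 1 = r := ⟨(s' + 1).toNat, by omega⟩
    have hr1 : s' + 3 = ((r + 1 : ℕ) : ℤ) + 1 := by push_cast; omega
    have hD : (1 : ℤ) ≤ d - 1 := by omega
    rw [hr1] at hdeg
    obtain ⟨i, j, hj1, hijr, hj, hij⟩ := exists_pos_add_mul_pos hα hsum hpos (r := r + 1)
      (by omega) (by omega) (key _ hdeg) hD
    obtain ⟨s, hs0, hsc, hX, hGs, hGd⟩ := exists_span_of_weight_nonpos hd hGhom hα hw hj1 hj hij
    have hlow := le_ringKrullDim_quotient_span s hs0 hsc (r := r + 1) (by omega)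
    let φ : MvPolynomial (Fin (N + 1)) k →+* MvPolynomial (Fin (N + 1)) k :=
      (aeval (fun i => ∑ j, C ((g : Matrix (Fin (N + 1)) (Fin (N + 1)) k) i j) *
        (X j : MvPolynomial (Fin (N + 1)) k)) : _ →ₐ[k] _).toRingHom
    have hφ (p) : φ p = substGL (↑g) p := rfl
    have hφinv (p) : φ (substGL (↑g⁻¹) p) = p := by
      rw [hφ, substGL_mul, g.inv_mul, substGL_one]
    have hup := hsing (substGL (↑g⁻¹) (X 0)) (substGL_ne_zero _ (X_ne_zero _))
      (isHomogeneous_substGL _ (isHomogeneous_X _ _))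
    have hJ : Ideal.span ({substGL (↑g⁻¹) (X 0), F} ∪ Set.range (fun i => pderiv i F)) ≤
        (Ideal.span s).comap φ := by
      rw [Ideal.span_le]
      rintro _ ((rfl | rfl) | ⟨l, rfl⟩)
      · simpa only [SetLike.mem_coe, Ideal.mem_comap, hφinv] using hX
      · exact hGs
      · rw [SetLike.mem_coe, Ideal.mem_comap, hφ, substGL_pderiv]
        exact Ideal.sum_mem _ fun q _ => Ideal.mul_mem_left _ _ (hGd q)
    have hle := ringKrullDim_le_of_surjective (Ideal.quotientMap _ φ hJ)
      (Ideal.quotientMap_surjective fun p => ⟨_, hφinv p⟩)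
    have hcontra := hlow.trans (hle.trans hup)
    rw [hr, Int.toNat_natCast] at hcontra
    norm_cast at hcontra
    omega

theorem adeg_pos_iff {k : Type*} [CommSemiring k] {n : ℕ} (α : Fin n → ℤ)
    {G : MvPolynomial (Fin n) k} :
    0 < adeg α G ↔ ∃ m ∈ G.support, 0 < ∑ i, (m i : ℤ) * α i := by
  unfold adeg
  split_ifs with h
  · exact Finset.lt_sup'_iff _
  · simp [Finset.not_nonempty_iff_eq_empty.1 h]

/-- Variant of the main theorem with hyperplane sections of the singular locus, stable
case: if the multiplicity of `H = {F = 0}` at every point is at most `δ`,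
`dim (H_sing ∩ V) ≤ s'` for every hyperplane `V = {ℓ = 0}` of `P^N_k`, and
`d > δ · min(N+1, s'+3)`, then `F` satisfies the Hilbert–Mumford criterion for
stability, i.e. `H` is stable. -/
theorem stable_of_deg_gt_hyperplane_sections {k : Type*} [Field k] [IsAlgClosed k]
    {N d : ℕ} (hN : 1 ≤ N) (hd : 2 ≤ d)
    (F : MvPolynomial (Fin (N+1)) k) (hF0 : F ≠ 0) (hFhom : F.IsHomogeneous d)
    (δ : ℕ) (hδ : 1 ≤ δ)
    (hmult : ∀ h : Matrix.GeneralLinearGroup (Fin (N+1)) k,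
      ord0 (dehom (substGL (↑h) F)) ≤ δ)
    (s' : ℤ) (hs' : -1 ≤ s')
    (hsing : ∀ ℓ : MvPolynomial (Fin (N+1)) k, ℓ ≠ 0 → ℓ.IsHomogeneous 1 →
      ringKrullDim (MvPolynomial (Fin (N+1)) k ⧸
          Ideal.span ({ℓ, F} ∪ Set.range (fun i => pderiv i F)))
        ≤ ((s'+1).toNat : WithBot ℕ∞))
    (hdeg : (δ : ℤ) * min ((N : ℤ) + 1) (s' + 3) < (d : ℤ)) :
    ∀ g : Matrix.GeneralLinearGroup (Fin (N+1)) k, ∀ α : Fin (N+1) → ℤ,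
      α ≠ 0 → (∑ i, α i) = 0 → 0 < adeg α (substGL (↑g) F) := by
  intro g α hα0 hsum
  rw [adeg_pos_iff]
  let σ := Tuple.sort α
  have hdet : IsUnit ((g : Matrix (Fin (N + 1)) (Fin (N + 1)) k).submatrix id σ) :=
    (Matrix.isUnit_submatrix_equiv (Equiv.refl _) σ).2 g.isUnit
  obtain ⟨h, hh⟩ := hdet
  obtain ⟨m, hm, hpos⟩ := exists_weight_pos_of_monotone hd hF0 hFhom hδ hs' hsing hdeg h
    (hmult h) (Tuple.monotone_sort α)
    (fun h0 => hα0 (funext fun i => by simpa [σ] using congr_fun h0 (σ.symm i)))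
    ((Equiv.sum_comp σ α).trans hsum)
  classical
  rw [hh, substGL_submatrix, support_rename_of_injective σ.symm.injective] at hm
  obtain ⟨m', hm', rfl⟩ := Finset.mem_image.1 hm
  refine ⟨m', hm', hpos.trans_eq ?_⟩
  refine Fintype.sum_equiv σ _ _ fun i => ?_
  have := Finsupp.mapDomain_apply σ.symm.injective m' (σ i)
  rw [Equiv.symm_apply_apply] at this
  rw [this]
  rfl
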